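/- arXiv:0908.2461 — 2 statements merged into one kernel-verified Lean document; each statement's English description precedes it below -/
import Mathlib

section
/- Suppose posIdx(U) = p₁, negIdx(U) = q₁, dim U = p₁ + q₁, posIdx(W) = p₂, negIdx(W) = q₂, dim W = p₂ + q₂. Let (r_U, r_W, a, a_U, a_W) be natural numbers satisfying r_U + a + a_U ≤ p₁, r_U + a + a_W ≤ q₁, r_W + a + a_W ≤ p₂, and r_W + a + a_U ≤ q₂. Then there exists an isotropic subspace S of V with dim(S ∩ U) = r_U, dim(S ∩ W) = r_W, dim Rad(proj_U S) = r_U + a, posIdx(proj_U S) = a_U, negIdx(proj_U S) = a_W, and dim S = r_U + r_W + a + a_U + a_W. -/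
open Module

/-- The projection of `S` onto `A` along the complement `C`: `(S + C) ⊓ A`. -/
def projAlong {k V : Type*} [Field k] [AddCommGroup V] [Module k V]
    (C A S : Submodule k V) : Submodule k V := (S ⊔ C) ⊓ A

/-- The radical of `T` with respect to `B`: `T ⊓ T^⊥`. -/
def bilinRad {k V : Type*} [Field k] [AddCommGroup V] [Module k V]
    (B : LinearMap.BilinForm k V) (T : Submodule k V) : Submodule k V :=
  T ⊓ B.orthogonal T

/-- The maximal dimension of a subspace of `T` on which `B` is positive definite. -/
noncomputable def posIdx {V : Type*} [AddCommGroup V] [Module ℝ V]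
    (B : LinearMap.BilinForm ℝ V) (T : Submodule ℝ V) : ℕ :=
  sSup {n : ℕ | ∃ T' : Submodule ℝ V, T' ≤ T ∧ (∀ v ∈ T', v ≠ 0 → 0 < B v v) ∧
    Module.finrank ℝ T' = n}

/-- The maximal dimension of a subspace of `T` on which `B` is negative definite. -/
noncomputable def negIdx {V : Type*} [AddCommGroup V] [Module ℝ V]
    (B : LinearMap.BilinForm ℝ V) (T : Submodule ℝ V) : ℕ :=
  sSup {n : ℕ | ∃ T' : Submodule ℝ V, T' ≤ T ∧ (∀ v ∈ T', v ≠ 0 → B v v < 0) ∧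
    Module.finrank ℝ T' = n}

section Index

variable {V : Type*} [AddCommGroup V] [Module ℝ V]

theorem dotProduct_self_nonneg {ι : Type*} [Fintype ι] (v : ι → ℝ) : 0 ≤ v ⬝ᵥ v :=
  Finset.sum_nonneg fun i _ => mul_self_nonneg (v i)

theorem negIdx_eq_posIdx_neg (B : LinearMap.BilinForm ℝ V) (T : Submodule ℝ V) :
    negIdx B T = posIdx (-B) T := by
  simp [negIdx, posIdx]

theorem exists_isometry_of_posDef (B : LinearMap.BilinForm ℝ V)
    (hB : ∀ x y, B x y = B y x) {P : Submodule ℝ V} [FiniteDimensional ℝ P]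
    (hP : ∀ v ∈ P, v ≠ 0 → 0 < B v v)
    {ι : Type*} [Fintype ι] (hι : Fintype.card ι ≤ finrank ℝ P) :
    ∃ E : (ι → ℝ) →ₗ[ℝ] V, (∀ v, E v ∈ P) ∧ ∀ v w, B (E v) (E w) = v ⬝ᵥ w := by
  classical
  have hsymm : LinearMap.IsSymm (B.restrict P) := ⟨fun x y => hB x y⟩
  let : Invertible (2 : ℝ) := invertibleOfNonzero two_ne_zero
  obtain ⟨b, hb⟩ := LinearMap.BilinForm.exists_orthogonal_basis (B := B.restrict P) hsymm
  obtain ⟨g⟩ : Nonempty (ι ↪ Fin (finrank ℝ P)) :=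
    Function.Embedding.nonempty_of_card_le (by simpa using hι)
  have hpos : ∀ i, 0 < B (b i) (b i) := fun i =>
    hP _ (b i).2 (by simpa using b.ne_zero i)
  have hort : ∀ i j, i ≠ j → B (b i) (b j) = 0 := fun i j hij => hb hij
  let e : ι → V := fun i => (Real.sqrt (B (b (g i)) (b (g i))))⁻¹ • (b (g i) : V)
  have he : ∀ i j, B (e i) (e j) = if i = j then 1 else 0 := by
    intro i j
    split_ifs with hij
    · subst hij
      have hs := Real.mul_self_sqrt (hpos (g i)).le
      have hs0 := (Real.sqrt_pos.2 (hpos (g i))).ne'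
      simp only [e, map_smul, LinearMap.smul_apply, smul_eq_mul]
      field_simp
      rw [pow_two, hs]
    · simp [e, hort _ _ (g.injective.ne hij)]
  refine ⟨Fintype.linearCombination ℝ e, fun v => ?_, fun v w => ?_⟩
  · rw [Fintype.linearCombination_apply]
    exact P.sum_mem fun i _ => P.smul_mem _ (P.smul_mem _ (b (g i)).2)
  · simp [Fintype.linearCombination_apply, he, dotProduct, mul_comm]

variable [FiniteDimensional ℝ V]

theorem exists_posDef_finrank_eq_posIdx (B : LinearMap.BilinForm ℝ V) (T : Submodule ℝ V) :
    ∃ P ≤ T, (∀ v ∈ P, v ≠ 0 → 0 < B v v) ∧ finrank ℝ P = posIdx B T := by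
  refine Nat.sSup_mem (s := {n : ℕ | ∃ T' : Submodule ℝ V, T' ≤ T ∧
    (∀ v ∈ T', v ≠ 0 → 0 < B v v) ∧ finrank ℝ T' = n}) ⟨0, ⊥, bot_le, ?_, by simp⟩
    ⟨finrank ℝ V, ?_⟩
  · intro v hv h0
    exact absurd ((Submodule.mem_bot ℝ).1 hv) h0
  · rintro n ⟨T', -, -, rfl⟩
    exact Submodule.finrank_le T'

theorem finrank_le_posIdx (B : LinearMap.BilinForm ℝ V) {P T : Submodule ℝ V} (hPT : P ≤ T)
    (hP : ∀ v ∈ P, v ≠ 0 → 0 < B v v) : finrank ℝ P ≤ posIdx B T := by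
  refine le_csSup ⟨finrank ℝ V, ?_⟩ ⟨P, hPT, hP, rfl⟩
  rintro n ⟨T', -, -, rfl⟩
  exact Submodule.finrank_le T'

/-- A positive definite subspace and a complementary negative semidefinite one compute the
positive index. -/
theorem posIdx_eq_of_finrank_add (B : LinearMap.BilinForm ℝ V) {P Q T : Submodule ℝ V}
    (hPT : P ≤ T) (hQT : Q ≤ T) (hP : ∀ v ∈ P, v ≠ 0 → 0 < B v v) (hQ : ∀ v ∈ Q, B v v ≤ 0)
    (hdim : finrank ℝ P + finrank ℝ Q = finrank ℝ T) : posIdx B T = finrank ℝ P := by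
  refine le_antisymm ?_ (finrank_le_posIdx B hPT hP)
  obtain ⟨P', hP'T, hP', hP'dim⟩ := exists_posDef_finrank_eq_posIdx B T
  have hbot : P' ⊓ Q = ⊥ := by
    rw [eq_bot_iff]
    rintro v ⟨hv, hvQ⟩
    by_contra h0
    exact absurd (hP' v hv h0) (not_lt.2 (hQ v hvQ))
  have h1 := Submodule.finrank_sup_add_finrank_inf_eq P' Q
  have h2 := Submodule.finrank_mono (sup_le hP'T hQT)
  rw [hbot, finrank_bot] at h1
  omega

/-- A subspace on which a symmetric form is nondegenerate splits orthogonally into a positive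
definite and a negative definite part. -/
theorem exists_orthogonal_posDef_negDef (B : LinearMap.BilinForm ℝ V)
    (hB : ∀ x y, B x y = B y x) {U : Submodule ℝ V}
    (hU : ∀ x ∈ U, (∀ y ∈ U, B x y = 0) → x = 0) :
    ∃ P ≤ U, ∃ N ≤ U, (∀ v ∈ P, v ≠ 0 → 0 < B v v) ∧ (∀ v ∈ N, v ≠ 0 → B v v < 0) ∧
      (∀ x ∈ P, ∀ y ∈ N, B x y = 0) ∧ finrank ℝ P = posIdx B U ∧
      finrank ℝ P + finrank ℝ N = finrank ℝ U := by
  obtain ⟨P, hPU, hP, hPdim⟩ := exists_posDef_finrank_eq_posIdx B U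
  have hrefl : B.IsRefl := fun x y h => by rw [hB, h]
  have hnd : (B.restrict P).Nondegenerate := by
    have hrr : (B.restrict P).IsRefl := fun x y h => by
      change B y x = 0
      rw [hB]; exact h
    refine hrr.nondegenerate_iff_separatingLeft.2 fun x hx => ?_
    by_contra h0
    exact (hP x x.2 (by simpa using h0)).ne' (hx x)
  have hc := LinearMap.BilinForm.isCompl_orthogonal_of_restrict_nondegenerate hrefl hnd
  have horth : ∀ x ∈ P, ∀ y ∈ B.orthogonal P ⊓ U, B x y = 0 := fun x hx y hy =>
    LinearMap.BilinForm.mem_orthogonal_iff.1 hy.1 x hx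
  have hsup : P ⊔ B.orthogonal P ⊓ U = U := by
    rw [← sup_inf_assoc_of_le _ hPU, hc.sup_eq_top, top_inf_eq]
  have hinf : P ⊓ (B.orthogonal P ⊓ U) = ⊥ := by
    rw [← inf_assoc, hc.inf_eq_bot, bot_inf_eq]
  have hdim := Submodule.finrank_sup_add_finrank_inf_eq P (B.orthogonal P ⊓ U)
  rw [hsup, hinf, finrank_bot] at hdim
  have hle : ∀ v ∈ B.orthogonal P ⊓ U, B v v ≤ 0 := by
    intro v hv
    by_contra! hpos
    have hv0 : v ≠ 0 := by rintro rfl; simp at hpos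
    have hvP : P ⊓ (ℝ ∙ v) = ⊥ := by
      rw [eq_bot_iff, ← hinf]
      exact inf_le_inf_left _ ((Submodule.span_singleton_le_iff_mem _ _).2 hv)
    have h1 := Submodule.finrank_sup_add_finrank_inf_eq P (ℝ ∙ v)
    rw [hvP, finrank_bot, finrank_span_singleton hv0] at h1
    have h2 := finrank_le_posIdx B (P := P ⊔ (ℝ ∙ v)) (T := U)
      (sup_le hPU ((Submodule.span_singleton_le_iff_mem _ _).2 hv.2)) (by
        intro z hz hz0
        obtain ⟨x, hx, y, hy, rfl⟩ := Submodule.mem_sup.1 hz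
        obtain ⟨t, rfl⟩ := Submodule.mem_span_singleton.1 hy
        have hxv := horth x hx v hv
        have hvx : B v x = 0 := by rw [hB, hxv]
        simp only [map_add, map_smul, LinearMap.add_apply, LinearMap.smul_apply, smul_eq_mul,
          hxv, hvx]
        by_cases hx0 : x = 0
        · subst hx0
          have ht : t ≠ 0 := by rintro rfl; simp at hz0
          have := mul_pos (mul_self_pos.2 ht) hpos
          simp only [map_zero]
          linarith
        · have := hP x hx hx0
          have := mul_nonneg (mul_self_nonneg t) hpos.le
          linarith)
    omega
  refine ⟨P, hPU, B.orthogonal P ⊓ U, inf_le_right, hP, fun v hv hv0 => ?_, horth, hPdim,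
    by omega⟩
  refine lt_of_le_of_ne (hle v hv) fun hvv => hv0 ?_
  have hN : ∀ y ∈ B.orthogonal P ⊓ U, B v y = 0 := by
    intro y hy
    by_contra hne
    have h := hle (((1 - B y y) / (2 * B v y)) • v + y)
      (Submodule.add_mem _ (Submodule.smul_mem _ _ hv) hy)
    simp only [map_add, map_smul, LinearMap.add_apply, LinearMap.smul_apply, smul_eq_mul,
      hvv, hB y v] at h
    have ht : (1 - B y y) / (2 * B v y) * B v y * 2 = 1 - B y y := by field_simp
    linarith
  refine hU v hv.2 fun y hy => ?_
  rw [← hsup] at hy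
  obtain ⟨x, hx, z, hz, rfl⟩ := Submodule.mem_sup.1 hy
  rw [map_add, hN z hz, hB v x, horth x hx v hv, add_zero]

/-- A nondegenerate subspace with large enough indices contains an isometric copy of the space
with null part indexed by `ι`, positive part by `κ` and negative part by `μ`; the null part is
spanned by sums of a unit vector and an orthogonal vector of norm `-1`. -/
theorem exists_injective_isometry (B : LinearMap.BilinForm ℝ V)
    (hB : ∀ x y, B x y = B y x) {U : Submodule ℝ V}
    (hU : ∀ x ∈ U, (∀ y ∈ U, B x y = 0) → x = 0)
    {ι κ μ : Type*} [Fintype ι] [Fintype κ] [Fintype μ]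
    (hpos : Fintype.card ι + Fintype.card κ ≤ posIdx B U)
    (hneg : Fintype.card ι + Fintype.card μ + posIdx B U ≤ finrank ℝ U) :
    ∃ F : (ι → ℝ) × (κ → ℝ) × (μ → ℝ) →ₗ[ℝ] V, Function.Injective F ∧ (∀ v, F v ∈ U) ∧
      ∀ v w, B (F v) (F w) = v.2.1 ⬝ᵥ w.2.1 - v.2.2 ⬝ᵥ w.2.2 := by
  obtain ⟨P, hPU, N, hNU, hP, hN, hPN, hPdim, hdim⟩ := exists_orthogonal_posDef_negDef B hB hU
  obtain ⟨E, hEP, hE⟩ := exists_isometry_of_posDef B hB hP (ι := ι ⊕ κ)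
    (by rw [Fintype.card_sum]; omega)
  obtain ⟨G, hGN, hG⟩ := exists_isometry_of_posDef (-B) (fun x y => by simp [hB x y]) (P := N)
    (fun v hv h0 => by simpa using hN v hv h0) (ι := ι ⊕ μ) (by rw [Fintype.card_sum]; omega)
  have hG' : ∀ v w, B (G v) (G w) = -(v ⬝ᵥ w) := fun v w => by rw [← hG]; simp
  have hEG : ∀ v w, B (E v) (G w) = 0 := fun v w => hPN _ (hEP v) _ (hGN w)
  have hGE : ∀ v w, B (G v) (E w) = 0 := fun v w => by rw [hB, hEG]
  let p : (ι → ℝ) × (κ → ℝ) × (μ → ℝ) →ₗ[ℝ] (ι ⊕ κ → ℝ) :=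
    (LinearEquiv.sumArrowLequivProdArrow ι κ ℝ ℝ).symm.toLinearMap ∘ₗ
      (LinearMap.id.prodMap (LinearMap.fst ℝ _ _))
  let n : (ι → ℝ) × (κ → ℝ) × (μ → ℝ) →ₗ[ℝ] (ι ⊕ μ → ℝ) :=
    (LinearEquiv.sumArrowLequivProdArrow ι μ ℝ ℝ).symm.toLinearMap ∘ₗ
      (LinearMap.id.prodMap (LinearMap.snd ℝ _ _))
  have hp : ∀ v w, p v ⬝ᵥ p w = v.1 ⬝ᵥ w.1 + v.2.1 ⬝ᵥ w.2.1 := fun v w => by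
    simp [p, dotProduct]
  have hn : ∀ v w, n v ⬝ᵥ n w = v.1 ⬝ᵥ w.1 + v.2.2 ⬝ᵥ w.2.2 := fun v w => by
    simp [n, dotProduct]
  refine ⟨E ∘ₗ p + G ∘ₗ n, ?_, fun v => U.add_mem (hPU (hEP _)) (hNU (hGN _)), fun v w => ?_⟩
  · rw [← LinearMap.ker_eq_bot, LinearMap.ker_eq_bot']
    intro v hv
    have h1 : B (E (p v) + G (n v)) (E (p v)) = 0 := by
      rw [show E (p v) + G (n v) = 0 from hv]; simp
    have h2 : B (E (p v) + G (n v)) (G (n v)) = 0 := by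
      rw [show E (p v) + G (n v) = 0 from hv]; simp
    simp only [map_add, LinearMap.add_apply, hE, hG', hEG, hGE, hp, hn] at h1 h2
    have a1 : 0 ≤ v.1 ⬝ᵥ v.1 := dotProduct_self_nonneg _
    have a2 : 0 ≤ v.2.1 ⬝ᵥ v.2.1 := dotProduct_self_nonneg _
    have a3 : 0 ≤ v.2.2 ⬝ᵥ v.2.2 := dotProduct_self_nonneg _
    refine Prod.ext (dotProduct_self_eq_zero.1 ?_) (Prod.ext (dotProduct_self_eq_zero.1 ?_)
      (dotProduct_self_eq_zero.1 ?_)) <;> linarith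
  · simp only [map_add, LinearMap.add_apply, LinearMap.comp_apply, hE, hG', hEG, hGE, hp, hn]
    ring

end Index

section Glue

variable {k V X Y K : Type*} [Field k] [AddCommGroup V] [Module k V]
  [AddCommGroup X] [Module k X] [AddCommGroup Y] [Module k Y] [AddCommGroup K] [Module k K]

/-- The linear map `(x, y, z) ↦ F (x, z) + G (y, z)`. -/
def glue (F : X × K →ₗ[k] V) (G : Y × K →ₗ[k] V) : X × Y × K →ₗ[k] V :=
  F ∘ₗ LinearMap.id.prodMap (LinearMap.snd k Y K) + G ∘ₗ LinearMap.snd k X (Y × K)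

theorem glue_apply (F : X × K →ₗ[k] V) (G : Y × K →ₗ[k] V) (v : X × Y × K) :
    glue F G v = F (v.1, v.2.2) + G v.2 := rfl

variable {F : X × K →ₗ[k] V} {G : Y × K →ₗ[k] V} {U W : Submodule k V}

theorem glue_injective (hUW : Disjoint U W) (hF : Function.Injective F)
    (hG : Function.Injective G) (hFU : ∀ v, F v ∈ U) (hGW : ∀ v, G v ∈ W) :
    Function.Injective (glue F G) := by
  rw [← LinearMap.ker_eq_bot, LinearMap.ker_eq_bot']
  rintro ⟨x, y, z⟩ h
  rw [glue_apply] at h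
  have h1 : F (x, z) = 0 := Submodule.disjoint_def.1 hUW _ (hFU _)
    (by rw [eq_neg_of_add_eq_zero_left h]; exact W.neg_mem (hGW _))
  have h2 : G (y, z) = 0 := by simpa [h1] using h
  have h1' := (map_eq_zero_iff F hF).1 h1
  have h2' := (map_eq_zero_iff G hG).1 h2
  simp_all

theorem finrank_range_glue_inf_left (hUW : Disjoint U W) (hF : Function.Injective F)
    (hG : Function.Injective G) (hFU : ∀ v, F v ∈ U) (hGW : ∀ v, G v ∈ W) :
    finrank k (LinearMap.range (glue F G) ⊓ U : Submodule k V) = finrank k X := by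
  have : LinearMap.range (glue F G) ⊓ U = LinearMap.range (F ∘ₗ LinearMap.inl k X K) := by
    ext v
    constructor
    · rintro ⟨⟨⟨x, y, z⟩, rfl⟩, hU⟩
      have h0 : G (y, z) = 0 := Submodule.disjoint_def.1 hUW _
        ((Submodule.add_mem_iff_right U (hFU (x, z))).1 hU) (hGW _)
      have h0' := (map_eq_zero_iff G hG).1 h0
      obtain ⟨rfl, rfl⟩ : y = 0 ∧ z = 0 := by simpa using h0'
      exact ⟨x, by simp [glue_apply, h0]⟩
    · rintro ⟨x, rfl⟩
      exact ⟨⟨(x, 0, 0), by simp [glue_apply, ← Prod.zero_eq_mk]⟩, hFU _⟩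
  rw [this]
  exact LinearMap.finrank_range_of_inj (hF.comp LinearMap.inl_injective)

theorem finrank_range_glue_inf_right (hUW : Disjoint U W) (hF : Function.Injective F)
    (hG : Function.Injective G) (hFU : ∀ v, F v ∈ U) (hGW : ∀ v, G v ∈ W) :
    finrank k (LinearMap.range (glue F G) ⊓ W : Submodule k V) = finrank k Y := by
  rw [← finrank_range_glue_inf_left hUW.symm hG hF hGW hFU]
  suffices h : LinearMap.range (glue F G) = LinearMap.range (glue G F) by rw [h]
  ext v
  constructor <;>
  · rintro ⟨⟨x, y, z⟩, rfl⟩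
    exact ⟨(y, x, z), by simp [glue_apply, add_comm]⟩

theorem projAlong_range_glue (hUW : Disjoint U W) (hFU : ∀ v, F v ∈ U) (hGW : ∀ v, G v ∈ W) :
    projAlong W U (LinearMap.range (glue F G)) = LinearMap.range F := by
  ext v
  constructor
  · rintro ⟨hv, hvU⟩
    obtain ⟨_, ⟨⟨x, y, z⟩, rfl⟩, w, hw, rfl⟩ := Submodule.mem_sup.1 hv
    rw [glue_apply, add_assoc] at hvU ⊢
    have h0 := Submodule.disjoint_def.1 hUW _
      ((Submodule.add_mem_iff_right U (hFU (x, z))).1 hvU) (W.add_mem (hGW _) hw)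
    exact ⟨(x, z), by simp [h0]⟩
  · rintro ⟨⟨x, z⟩, rfl⟩
    refine ⟨Submodule.mem_sup.2 ⟨_, ⟨(x, 0, z), rfl⟩, -G (0, z), W.neg_mem (hGW _), ?_⟩, hFU _⟩
    simp [glue_apply]

end Glue

section RangeInvariants

variable {V X : Type*} [AddCommGroup V] [Module ℝ V] [AddCommGroup X] [Module ℝ X]
  {κ μ : Type*} [Fintype κ] [Fintype μ] {B : LinearMap.BilinForm ℝ V}
  {F : X × (κ → ℝ) × (μ → ℝ) →ₗ[ℝ] V}

theorem finrank_bilinRad_range (hF : Function.Injective F)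
    (hB : ∀ v w, B (F v) (F w) = v.2.1 ⬝ᵥ w.2.1 - v.2.2 ⬝ᵥ w.2.2) :
    finrank ℝ (bilinRad B (LinearMap.range F)) = finrank ℝ X := by
  have : bilinRad B (LinearMap.range F) = LinearMap.range (F ∘ₗ LinearMap.inl ℝ X _) := by
    ext v
    constructor
    · rintro ⟨⟨⟨x, p, n⟩, rfl⟩, h⟩
      have h' := LinearMap.BilinForm.mem_orthogonal_iff.1 h
      have h1 : B (F (0, p, 0)) (F (x, p, n)) = 0 := h' _ ⟨_, rfl⟩
      have h2 : B (F (0, 0, n)) (F (x, p, n)) = 0 := h' _ ⟨_, rfl⟩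
      simp only [hB, zero_dotProduct, sub_zero, zero_sub, neg_eq_zero,
        dotProduct_self_eq_zero] at h1 h2
      subst h1 h2
      exact ⟨x, rfl⟩
    · rintro ⟨x, rfl⟩
      refine ⟨⟨_, rfl⟩, LinearMap.BilinForm.mem_orthogonal_iff.2 ?_⟩
      rintro _ ⟨w, rfl⟩
      change B _ (F (x, 0, 0)) = 0
      simp [hB]
  rw [this]
  exact LinearMap.finrank_range_of_inj (hF.comp LinearMap.inl_injective)

theorem posIdx_range [FiniteDimensional ℝ V] [FiniteDimensional ℝ X] (hF : Function.Injective F)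
    (hB : ∀ v w, B (F v) (F w) = v.2.1 ⬝ᵥ w.2.1 - v.2.2 ⬝ᵥ w.2.2) :
    posIdx B (LinearMap.range F) = Fintype.card κ := by
  let i : (κ → ℝ) →ₗ[ℝ] X × (κ → ℝ) × (μ → ℝ) := LinearMap.inr ℝ _ _ ∘ₗ LinearMap.inl ℝ _ _
  let j : X × (μ → ℝ) →ₗ[ℝ] X × (κ → ℝ) × (μ → ℝ) :=
    LinearMap.id.prodMap (LinearMap.inr ℝ _ _)
  have hi : Function.Injective i := LinearMap.inr_injective.comp LinearMap.inl_injective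
  have hj : Function.Injective j := Function.injective_id.prodMap LinearMap.inr_injective
  have h1 : finrank ℝ (LinearMap.range (F ∘ₗ i)) = Fintype.card κ := by
    rw [LinearMap.finrank_range_of_inj (f := F ∘ₗ i) (hF.comp hi), finrank_fintype_fun_eq_card]
  have h2 : finrank ℝ (LinearMap.range (F ∘ₗ j)) = finrank ℝ X + Fintype.card μ := by
    rw [LinearMap.finrank_range_of_inj (f := F ∘ₗ j) (hF.comp hj), finrank_prod,
      finrank_fintype_fun_eq_card]
  rw [← h1]
  refine posIdx_eq_of_finrank_add B (Q := LinearMap.range (F ∘ₗ j))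
    (LinearMap.range_comp_le_range _ _) (LinearMap.range_comp_le_range _ _) ?_ ?_ ?_
  · rintro _ ⟨p, rfl⟩ h0
    have hp : p ≠ 0 := by rintro rfl; simp at h0
    have hnn : 0 ≤ p ⬝ᵥ p := dotProduct_self_nonneg _
    have : B (F (0, p, 0)) (F (0, p, 0)) = p ⬝ᵥ p := by simp [hB]
    exact this ▸ lt_of_le_of_ne hnn fun h => hp (dotProduct_self_eq_zero.1 h.symm)
  · rintro _ ⟨⟨x, n⟩, rfl⟩
    have hnn : 0 ≤ n ⬝ᵥ n := dotProduct_self_nonneg _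
    have : B (F (x, 0, n)) (F (x, 0, n)) = -(n ⬝ᵥ n) := by simp [hB]
    change B (F (x, 0, n)) (F (x, 0, n)) ≤ 0
    linarith
  · rw [h1, h2, LinearMap.finrank_range_of_inj hF, finrank_prod, finrank_prod,
      finrank_fintype_fun_eq_card, finrank_fintype_fun_eq_card]
    omega

theorem negIdx_range [FiniteDimensional ℝ V] [FiniteDimensional ℝ X] (hF : Function.Injective F)
    (hB : ∀ v w, B (F v) (F w) = v.2.1 ⬝ᵥ w.2.1 - v.2.2 ⬝ᵥ w.2.2) :
    negIdx B (LinearMap.range F) = Fintype.card μ := by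
  let s : (X × (μ → ℝ) × (κ → ℝ)) ≃ₗ[ℝ] X × (κ → ℝ) × (μ → ℝ) :=
    (LinearEquiv.refl ℝ X).prodCongr (LinearEquiv.prodComm ℝ (μ → ℝ) (κ → ℝ))
  rw [negIdx_eq_posIdx_neg, ← LinearEquiv.range_comp s F]
  refine posIdx_range (hF.comp s.injective) fun v w => ?_
  simp [hB, s]

end RangeInvariants

/-- existence of an isotropic subspace with prescribed invariants
`(r_U, r_W, a, a_U, a_W)` subject to the four inequalities. -/
theorem stmt_6 (V : Type*) [AddCommGroup V] [Module ℝ V] [FiniteDimensional ℝ V]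
    (B : LinearMap.BilinForm ℝ V)
    (hBsymm : ∀ x y : V, B x y = B y x)
    (hBnd : ∀ x : V, (∀ y : V, B x y = 0) → x = 0)
    (U W : Submodule ℝ V) (hUW : U ⊓ W = ⊥) (hUWtop : U ⊔ W = ⊤)
    (horth : ∀ u ∈ U, ∀ w ∈ W, B u w = 0)
    (p₁ q₁ p₂ q₂ : ℕ)
    (hU1 : posIdx B U = p₁) (hU2 : negIdx B U = q₁) (hU3 : finrank ℝ U = p₁ + q₁)
    (hW1 : posIdx B W = p₂) (hW2 : negIdx B W = q₂) (hW3 : finrank ℝ W = p₂ + q₂)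
    (rU rW a aU aW : ℕ)
    (c1 : rU + a + aU ≤ p₁) (c2 : rU + a + aW ≤ q₁)
    (c3 : rW + a + aW ≤ p₂) (c4 : rW + a + aU ≤ q₂) :
    ∃ S : Submodule ℝ V, (∀ s ∈ S, ∀ s' ∈ S, B s s' = 0) ∧
      finrank ℝ (S ⊓ U : Submodule ℝ V) = rU ∧
      finrank ℝ (S ⊓ W : Submodule ℝ V) = rW ∧
      finrank ℝ (bilinRad B (projAlong W U S)) = rU + a ∧
      posIdx B (projAlong W U S) = aU ∧
      negIdx B (projAlong W U S) = aW ∧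
      finrank ℝ S = rU + rW + a + aU + aW := by
  have hdisj : Disjoint U W := disjoint_iff.2 hUW
  have hUnd : ∀ x ∈ U, (∀ y ∈ U, B x y = 0) → x = 0 := by
    intro x hx h
    refine hBnd x fun y => ?_
    obtain ⟨u, hu, w, hw, rfl⟩ := Submodule.mem_sup.1 (hUWtop ▸ Submodule.mem_top : y ∈ U ⊔ W)
    rw [map_add, h u hu, horth x hx w hw, add_zero]
  have hWnd : ∀ x ∈ W, (∀ y ∈ W, B x y = 0) → x = 0 := by
    intro x hx h
    refine hBnd x fun y => ?_
    obtain ⟨u, hu, w, hw, rfl⟩ := Submodule.mem_sup.1 (hUWtop ▸ Submodule.mem_top : y ∈ U ⊔ W)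
    rw [map_add, h w hw, hBsymm, horth u hu x hx, add_zero]
  obtain ⟨F₀, hF₀, hF₀U, hF₀B⟩ := exists_injective_isometry B hBsymm hUnd
    (ι := Fin rU ⊕ Fin a) (κ := Fin aU) (μ := Fin aW)
    (by simp only [Fintype.card_sum, Fintype.card_fin]; omega)
    (by simp only [Fintype.card_sum, Fintype.card_fin]; omega)
  obtain ⟨G₀, hG₀, hG₀W, hG₀B⟩ := exists_injective_isometry B hBsymm hWnd
    (ι := Fin rW ⊕ Fin a) (κ := Fin aW) (μ := Fin aU)
    (by simp only [Fintype.card_sum, Fintype.card_fin]; omega)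
    (by simp only [Fintype.card_sum, Fintype.card_fin]; omega)
  let split (r : ℕ) {p n : ℕ} : ((Fin r → ℝ) × (Fin a → ℝ) × (Fin p → ℝ) × (Fin n → ℝ)) ≃ₗ[ℝ]
      (Fin r ⊕ Fin a → ℝ) × (Fin p → ℝ) × (Fin n → ℝ) :=
    (LinearEquiv.prodAssoc ℝ _ _ ((Fin p → ℝ) × (Fin n → ℝ))).symm ≪≫ₗ
      (LinearEquiv.sumArrowLequivProdArrow (Fin r) (Fin a) ℝ ℝ).symm.prodCongr
        (LinearEquiv.refl ℝ _)
  let swap : ((Fin rW → ℝ) × (Fin a → ℝ) × (Fin aU → ℝ) × (Fin aW → ℝ)) ≃ₗ[ℝ]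
      (Fin rW → ℝ) × (Fin a → ℝ) × (Fin aW → ℝ) × (Fin aU → ℝ) :=
    (LinearEquiv.refl ℝ _).prodCongr ((LinearEquiv.refl ℝ _).prodCongr
      (LinearEquiv.prodComm ℝ (Fin aU → ℝ) (Fin aW → ℝ)))
  let F := F₀ ∘ₗ (split rU).toLinearMap
  let G := G₀ ∘ₗ (swap ≪≫ₗ split rW).toLinearMap
  have hF : Function.Injective F := hF₀.comp (split rU).injective
  have hG : Function.Injective G := hG₀.comp (swap ≪≫ₗ split rW).injective
  have hFU : ∀ v, F v ∈ U := fun v => hF₀U _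
  have hGW : ∀ v, G v ∈ W := fun v => hG₀W _
  have hFB : ∀ v w, B (F v) (F w) = v.2.2.1 ⬝ᵥ w.2.2.1 - v.2.2.2 ⬝ᵥ w.2.2.2 :=
    fun v w => hF₀B _ _
  have hGB : ∀ v w, B (G v) (G w) = v.2.2.2 ⬝ᵥ w.2.2.2 - v.2.2.1 ⬝ᵥ w.2.2.1 :=
    fun v w => hG₀B _ _
  have hproj : projAlong W U (LinearMap.range (glue F G)) = LinearMap.range F₀ := by
    rw [projAlong_range_glue hdisj hFU hGW]
    exact LinearEquiv.range_comp (split rU) F₀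
  refine ⟨LinearMap.range (glue F G), ?_, ?_, ?_, ?_, ?_, ?_, ?_⟩
  · rintro _ ⟨v, rfl⟩ _ ⟨w, rfl⟩
    simp only [glue_apply, map_add, LinearMap.add_apply, hFB, hGB, horth _ (hFU _) _ (hGW _),
      hBsymm (G _) (F _)]
    ring
  · rw [finrank_range_glue_inf_left hdisj hF hG hFU hGW, finrank_fin_fun]
  · rw [finrank_range_glue_inf_right hdisj hF hG hFU hGW, finrank_fin_fun]
  · rw [hproj, finrank_bilinRad_range hF₀ hF₀B]
    simp
  · rw [hproj, posIdx_range hF₀ hF₀B, Fintype.card_fin]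
  · rw [hproj, negIdx_range hF₀ hF₀B, Fintype.card_fin]
  · rw [LinearMap.finrank_range_of_inj (glue_injective hdisj hF hG hFU hGW)]
    simp only [finrank_prod, finrank_fin_fun]
    ring
end

section
/- Suppose posIdx(U) = p₁, negIdx(U) = q₁, dim U = p₁ + q₁, posIdx(W) = p₂, negIdx(W) = q₂, dim W = p₂ + q₂. Let (r_U, r_W, a, a_U, a_W) be natural numbers satisfying r_U + a + a_U ≤ p₁, r_U + a + a_W ≤ q₁, r_W + a + a_W ≤ p₂, and r_W + a + a_U ≤ q₂. Then there exists an isotropic subspace S of V with dim(S ∩ U) = r_U, dim(S ∩ W) = r_W, dim Rad(proj_U S) = r_U + a, posIdx(proj_U S) = a_U, negIdx(proj_U S) = a_W, and dim S = r_U + r_W + a + a_U + a_W. -/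
open Module
open scoped ComplexOrder

/-- Orthogonal complement `T^⊥ = {v | ∀ t ∈ T, B t v = 0}` of a subspace with respect
to a sesquilinear form `B`. -/
def sesqOrth {V : Type*} [AddCommGroup V] [Module ℂ V]
    (B : V →ₛₗ[starRingEnd ℂ] V →ₗ[ℂ] ℂ) (T : Submodule ℂ V) : Submodule ℂ V where
  carrier := {v | ∀ t ∈ T, B t v = 0}
  add_mem' := by
    intro a b ha hb t ht
    simp [map_add, ha t ht, hb t ht]
  zero_mem' := by intro t ht; simp
  smul_mem' := by
    intro c v hv t ht
    simp [map_smul, hv t ht]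

/-- The radical `T ⊓ T^⊥` of a subspace with respect to a sesquilinear form `B`. -/
def sesqRad {V : Type*} [AddCommGroup V] [Module ℂ V]
    (B : V →ₛₗ[starRingEnd ℂ] V →ₗ[ℂ] ℂ) (T : Submodule ℂ V) : Submodule ℂ V :=
  T ⊓ sesqOrth B T

/-- The maximal dimension of a subspace of `T` on which `B v v > 0` for all nonzero `v`. -/
noncomputable def posIdxH {V : Type*} [AddCommGroup V] [Module ℂ V]
    (B : V →ₛₗ[starRingEnd ℂ] V →ₗ[ℂ] ℂ) (T : Submodule ℂ V) : ℕ :=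
  sSup {n : ℕ | ∃ T' : Submodule ℂ V, T' ≤ T ∧ (∀ v ∈ T', v ≠ 0 → 0 < B v v) ∧
    Module.finrank ℂ T' = n}

/-- The maximal dimension of a subspace of `T` on which `B v v < 0` for all nonzero `v`. -/
noncomputable def negIdxH {V : Type*} [AddCommGroup V] [Module ℂ V]
    (B : V →ₛₗ[starRingEnd ℂ] V →ₗ[ℂ] ℂ) (T : Submodule ℂ V) : ℕ :=
  sSup {n : ℕ | ∃ T' : Submodule ℂ V, T' ≤ T ∧ (∀ v ∈ T', v ≠ 0 → B v v < 0) ∧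
    Module.finrank ℂ T' = n}


theorem sumElim_smul_smul {α β R M : Type*} [SMul R M] (c : R) (x : α → M) (y : β → M) :
    Sum.elim (c • x) (c • y) = c • Sum.elim x y := by
  ext (i | i) <;> rfl

section HermitianForms

variable {V : Type*} [AddCommGroup V] [Module ℂ V]

theorem posIdxH_neg (B : V →ₛₗ[starRingEnd ℂ] V →ₗ[ℂ] ℂ) (T : Submodule ℂ V) :
    posIdxH (-B) T = negIdxH B T := by
  simp [posIdxH, negIdxH]

/-- The part of a negative definite subspace orthogonal to an isometric copy of a standard
Hermitian space: orthogonal projection preserves dimension and negativity. -/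
theorem exists_neg_orthogonal {ι : Type*} [Fintype ι] (B : V →ₛₗ[starRingEnd ℂ] V →ₗ[ℂ] ℂ)
    (hB : ∀ x y : V, B y x = starRingEnd ℂ (B x y)) (E : (ι → ℂ) →ₗ[ℂ] V)
    (hE : ∀ x y, B (E x) (E y) = star x ⬝ᵥ y) (U Q : Submodule ℂ V) (hEU : ∀ x, E x ∈ U)
    (hQU : Q ≤ U) (hQ : ∀ v ∈ Q, v ≠ 0 → B v v < 0) :
    ∃ Q' : Submodule ℂ V, Q' ≤ U ∧ (∀ v ∈ Q', v ≠ 0 → B v v < 0) ∧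
      (∀ x, ∀ v ∈ Q', B (E x) v = 0) ∧ finrank ℂ Q' = finrank ℂ Q := by
  classical
  let c : V →ₗ[ℂ] (ι → ℂ) := LinearMap.pi fun i => B (E (Pi.single i 1))
  have hc : ∀ x v, B (E x) v = star x ⬝ᵥ c v := fun x v => by
    conv_lhs => rw [← (Pi.basisFun ℂ ι).sum_repr x]
    simp [c, dotProduct]
  let f : V →ₗ[ℂ] V := LinearMap.id - E ∘ₗ c
  have hfo : ∀ x v, B (E x) (f v) = 0 := fun x v => by
    simp only [f, LinearMap.sub_apply, LinearMap.id_apply, LinearMap.comp_apply, map_sub, hE]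
    rw [hc, sub_self]
  have hff : ∀ v, B (f v) (f v) = B v v - star (c v) ⬝ᵥ c v := fun v => by
    have h1 : B (f v) (f v) = B v (f v) := by
      conv_lhs => enter [1]; simp only [f]
      simp [hfo]
    have h2 : B v (E (c v)) = star (c v) ⬝ᵥ c v := by
      rw [hB (E (c v)), hc]
      exact (Matrix.star_dotProduct _ _).symm
    rw [h1]
    simp [f, h2]
  have hneg : ∀ v ∈ Q, v ≠ 0 → B (f v) (f v) < 0 := fun v hv h0 => by
    rw [hff]
    exact (sub_le_self _ (dotProduct_star_self_nonneg _)).trans_lt (hQ v hv h0)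
  refine ⟨Q.map f, ?_, ?_, ?_, ?_⟩
  · rintro _ ⟨v, hv, rfl⟩
    exact U.sub_mem (hQU hv) (hEU _)
  · rintro _ ⟨v, hv, rfl⟩ h
    exact hneg v hv (by rintro rfl; simp at h)
  · rintro x _ ⟨v, -, rfl⟩
    exact hfo x v
  · rw [← LinearMap.range_domRestrict]
    refine LinearMap.finrank_range_of_inj ((injective_iff_map_eq_zero _).2 fun v hv => ?_)
    by_contra h
    have := hneg v v.2 (by simpa using h)
    rw [show f v = 0 from hv] at this
    simp at this

theorem finrank_sesqRad_range {R : Type*} [AddCommGroup R] [Module ℂ R] {π ν : Type*}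
    [Fintype π] [Fintype ν] (B : V →ₛₗ[starRingEnd ℂ] V →ₗ[ℂ] ℂ)
    (g : (R × (π → ℂ) × (ν → ℂ)) →ₗ[ℂ] V) (hinj : Function.Injective g)
    (hg : ∀ x y, B (g x) (g y) = star x.2.1 ⬝ᵥ y.2.1 - star x.2.2 ⬝ᵥ y.2.2) :
    finrank ℂ (sesqRad B g.range) = finrank ℂ R := by
  have : sesqRad B g.range = (g ∘ₗ LinearMap.inl ℂ R _).range := by
    ext v
    constructor
    · rintro ⟨⟨x, rfl⟩, hx⟩
      have h1 : x.2.1 = 0 := by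
        simpa [hg] using hx (g (0, x.2.1, 0)) ⟨_, rfl⟩
      have h2 : x.2.2 = 0 := by
        simpa [hg] using hx (g (0, 0, x.2.2)) ⟨_, rfl⟩
      exact ⟨x.1, congrArg g (Prod.ext rfl (Prod.ext h1.symm h2.symm))⟩
    · rintro ⟨x, rfl⟩
      refine ⟨⟨_, rfl⟩, ?_⟩
      rintro _ ⟨y, rfl⟩
      simp [hg]
  rw [this, LinearMap.finrank_range_of_inj (f := g ∘ₗ _) (hinj.comp LinearMap.inl_injective)]

variable [FiniteDimensional ℂ V]

theorem bddAbove_posIdxH (B : V →ₛₗ[starRingEnd ℂ] V →ₗ[ℂ] ℂ) (T : Submodule ℂ V) :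
    BddAbove {n : ℕ | ∃ T' : Submodule ℂ V, T' ≤ T ∧ (∀ v ∈ T', v ≠ 0 → 0 < B v v) ∧
      finrank ℂ T' = n} := by
  refine ⟨finrank ℂ V, ?_⟩
  rintro n ⟨T', -, -, rfl⟩
  exact T'.finrank_le

theorem exists_finrank_eq_posIdxH (B : V →ₛₗ[starRingEnd ℂ] V →ₗ[ℂ] ℂ) (T : Submodule ℂ V) :
    ∃ T' : Submodule ℂ V, T' ≤ T ∧ (∀ v ∈ T', v ≠ 0 → 0 < B v v) ∧
      finrank ℂ T' = posIdxH B T :=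
  Nat.sSup_mem (s := {n : ℕ | ∃ T' : Submodule ℂ V, T' ≤ T ∧ (∀ v ∈ T', v ≠ 0 → 0 < B v v) ∧
    finrank ℂ T' = n}) ⟨0, ⊥, bot_le, by simp, by simp⟩ (bddAbove_posIdxH B T)

theorem exists_finrank_eq_negIdxH (B : V →ₛₗ[starRingEnd ℂ] V →ₗ[ℂ] ℂ) (T : Submodule ℂ V) :
    ∃ T' : Submodule ℂ V, T' ≤ T ∧ (∀ v ∈ T', v ≠ 0 → B v v < 0) ∧
      finrank ℂ T' = negIdxH B T := by
  simpa [posIdxH_neg] using exists_finrank_eq_posIdxH (-B) T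

/-- A positive definite subspace contains an isometric copy of every standard Hermitian space
of at most its dimension. -/
theorem exists_isometry_of_pos {ι : Type*} [Fintype ι] (B : V →ₛₗ[starRingEnd ℂ] V →ₗ[ℂ] ℂ)
    (hB : ∀ x y : V, B y x = starRingEnd ℂ (B x y)) (T : Submodule ℂ V)
    (hT : ∀ v ∈ T, v ≠ 0 → 0 < B v v) (hι : Fintype.card ι ≤ finrank ℂ T) :
    ∃ E : (ι → ℂ) →ₗ[ℂ] V, (∀ x, E x ∈ T) ∧ ∀ x y, B (E x) (E y) = star x ⬝ᵥ y := by
  classical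
  let core : InnerProductSpace.Core ℂ T :=
    { inner := fun x y => B x y
      conj_inner_symm := fun x y => (hB y x).symm
      re_inner_nonneg := fun x => by
        by_cases hx : (x : V) = 0
        · simp [hx]
        · exact (Complex.pos_iff.1 (hT x x.2 hx)).1.le
      add_left := fun x y z => by simp
      smul_left := fun x y r => by simp
      definite := fun x hx => by
        by_contra h
        exact (hT x x.2 (by simpa using h)).ne' hx }
  let _ : NormedAddCommGroup T := core.toNormedAddCommGroup
  let _ : InnerProductSpace ℂ T := InnerProductSpace.ofCore core.toCore
  let b := stdOrthonormalBasis ℂ T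
  obtain ⟨φ⟩ : Nonempty (ι ↪ Fin (finrank ℂ T)) :=
    Function.Embedding.nonempty_of_card_le (by simpa using hι)
  refine ⟨Fintype.linearCombination ℂ fun i => (b (φ i) : V), fun x => ?_, fun x y => ?_⟩
  · exact T.sum_mem fun i _ => T.smul_mem _ (b (φ i)).2
  · have hb : ∀ i j, B (b (φ i)) (b (φ j)) = if i = j then 1 else 0 := fun i j => by
      have := orthonormal_iff_ite.1 b.orthonormal (φ i) (φ j)
      exact this.trans (by simp [φ.injective.eq_iff])
    simp [Fintype.linearCombination_apply, hb, dotProduct, mul_comm]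

/-- A subspace of large enough positive and negative index contains a copy of every
diagonal Hermitian form. -/
theorem exists_diagonal_embedding {ρ π ν : Type*} [Fintype ρ] [Fintype π] [Fintype ν]
    (B : V →ₛₗ[starRingEnd ℂ] V →ₗ[ℂ] ℂ) (hB : ∀ x y : V, B y x = starRingEnd ℂ (B x y))
    (U : Submodule ℂ V) (hpos : Fintype.card ρ + Fintype.card π ≤ posIdxH B U)
    (hneg : Fintype.card ρ + Fintype.card ν ≤ negIdxH B U) :
    ∃ g : ((ρ → ℂ) × (π → ℂ) × (ν → ℂ)) →ₗ[ℂ] V, (∀ x, g x ∈ U) ∧ Function.Injective g ∧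
      ∀ x y, B (g x) (g y) = star x.2.1 ⬝ᵥ y.2.1 - star x.2.2 ⬝ᵥ y.2.2 := by
  obtain ⟨T, hTU, hT, hTdim⟩ := exists_finrank_eq_posIdxH B U
  obtain ⟨Q₀, hQ₀U, hQ₀, hQ₀dim⟩ := exists_finrank_eq_negIdxH B U
  obtain ⟨E, hET, hE⟩ := exists_isometry_of_pos (ι := ρ ⊕ π) B hB T hT (by simpa [hTdim])
  obtain ⟨Q, hQU, hQ, hEQ, hQdim⟩ :=
    exists_neg_orthogonal B hB E hE U Q₀ (fun x => hTU (hET x)) hQ₀U hQ₀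
  obtain ⟨F, hFQ, hF⟩ := exists_isometry_of_pos (ι := ρ ⊕ ν) (-B)
    (fun x y => by simp [hB x y]) Q (by simpa using hQ) (by simpa [hQdim, hQ₀dim])
  have hEF : ∀ x y, B (E x) (F y) = 0 := fun x y => hEQ x _ (hFQ y)
  have hFE : ∀ x y, B (F x) (E y) = 0 := fun x y => by rw [hB, hEF, map_zero]
  have hF' : ∀ x y, B (F x) (F y) = -(star x ⬝ᵥ y) := fun x y => by simp [← hF]
  let g : ((ρ → ℂ) × (π → ℂ) × (ν → ℂ)) →ₗ[ℂ] V :=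
    { toFun := fun x => E (Sum.elim x.1 x.2.1) + F (Sum.elim x.1 x.2.2)
      map_add' := fun x y => by
        simp only [Prod.fst_add, Prod.snd_add, Sum.elim_add_add, map_add]
        abel
      map_smul' := fun c x => by
        simp only [Prod.smul_fst, Prod.smul_snd, sumElim_smul_smul, map_smul,
          RingHom.id_apply, smul_add] }
  have hg : ∀ x, g x = E (Sum.elim x.1 x.2.1) + F (Sum.elim x.1 x.2.2) := fun _ => rfl
  refine ⟨g, fun x => U.add_mem (hTU (hET _)) (hQU (hFQ _)), ?_, fun x y => ?_⟩
  · refine (injective_iff_map_eq_zero g).2 fun x hx => ?_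
    have h1 := congrArg (B (E (Sum.elim x.1 x.2.1))) hx
    rw [hg, map_add, hE, hEF, add_zero, map_zero, dotProduct_star_self_eq_zero] at h1
    have h2 := congrArg (B (F (Sum.elim x.1 x.2.2))) hx
    rw [hg, map_add, hF', hFE, zero_add, map_zero, neg_eq_zero,
      dotProduct_star_self_eq_zero] at h2
    ext i
    · exact congrFun h1 (Sum.inl i)
    · exact congrFun h1 (Sum.inr i)
    · exact congrFun h2 (Sum.inr i)
  · simp [hg, hE, hF', hEF, hFE, Function.star_sumElim, sumElim_dotProduct_sumElim]
    ring

section DiagonalEmbedding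

variable {R : Type*} [AddCommGroup R] [Module ℂ R] {π ν : Type*} [Fintype π] [Fintype ν]
  (B : V →ₛₗ[starRingEnd ℂ] V →ₗ[ℂ] ℂ) (g : (R × (π → ℂ) × (ν → ℂ)) →ₗ[ℂ] V)

theorem posIdxH_range (hinj : Function.Injective g)
    (hg : ∀ x y, B (g x) (g y) = star x.2.1 ⬝ᵥ y.2.1 - star x.2.2 ⬝ᵥ y.2.2) :
    posIdxH B g.range = Fintype.card π := by
  refine le_antisymm (csSup_le' ?_) (le_csSup (bddAbove_posIdxH B g.range) ?_)
  · rintro n ⟨T, hTg, hT, rfl⟩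
    rw [← Submodule.map_comap_eq_self hTg, ← LinearMap.range_domRestrict,
      LinearMap.finrank_range_of_inj (f := g.domRestrict _) (hinj.comp Subtype.val_injective)]
    let p : T.comap g →ₗ[ℂ] (π → ℂ) :=
      (LinearMap.fst ℂ (π → ℂ) (ν → ℂ) ∘ₗ LinearMap.snd ℂ R _).domRestrict (T.comap g)
    have hp : Function.Injective p := (injective_iff_map_eq_zero p).2 fun x hx => by
      have hx' : x.1.2.1 = 0 := hx
      by_contra h
      have hpos := hT (g x) x.2 fun h0 => h (Subtype.ext (hinj (by simpa using h0)))
      rw [hg, hx', dotProduct_zero, zero_sub, neg_pos] at hpos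
      exact (dotProduct_star_self_nonneg _).not_gt hpos
    simpa using LinearMap.finrank_le_finrank_of_injective hp
  · let h : (π → ℂ) →ₗ[ℂ] V := g ∘ₗ LinearMap.inr ℂ R _ ∘ₗ LinearMap.inl ℂ _ _
    refine ⟨h.range, LinearMap.range_comp_le_range _ _, ?_, ?_⟩
    · rintro _ ⟨x, rfl⟩ hx
      have : B (h x) (h x) = star x ⬝ᵥ x := by simp [h, hg]
      rw [this]
      exact (dotProduct_star_self_nonneg x).lt_of_ne' fun h0 => hx (by
        rw [dotProduct_star_self_eq_zero.1 h0, map_zero])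
    · rw [LinearMap.finrank_range_of_inj (f := h)
        (hinj.comp (LinearMap.inr_injective.comp LinearMap.inl_injective))]
      simp

theorem negIdxH_range (hinj : Function.Injective g)
    (hg : ∀ x y, B (g x) (g y) = star x.2.1 ⬝ᵥ y.2.1 - star x.2.2 ⬝ᵥ y.2.2) :
    negIdxH B g.range = Fintype.card ν := by
  let e : (R × (ν → ℂ) × (π → ℂ)) ≃ₗ[ℂ] (R × (π → ℂ) × (ν → ℂ)) :=
    (LinearEquiv.refl ℂ R).prodCongr (LinearEquiv.prodComm ℂ _ _)
  rw [← posIdxH_neg, ← LinearEquiv.range_comp e g]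
  refine posIdxH_range (-B) (g ∘ₗ e.toLinearMap) (hinj.comp e.injective) fun x y => ?_
  simp [hg, e]

end DiagonalEmbedding

end HermitianForms


/-- existence of an isotropic subspace with prescribed invariants
`(r_U, r_W, a, a_U, a_W)` subject to the four inequalities (unitary case). -/
theorem stmt_8 (V : Type*) [AddCommGroup V] [Module ℂ V] [FiniteDimensional ℂ V]
    (B : V →ₛₗ[starRingEnd ℂ] V →ₗ[ℂ] ℂ)
    (hBherm : ∀ x y : V, B y x = starRingEnd ℂ (B x y))
    (hBnd : ∀ x : V, (∀ y : V, B x y = 0) → x = 0)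
    (U W : Submodule ℂ V) (hUW : U ⊓ W = ⊥) (hUWtop : U ⊔ W = ⊤)
    (horth : ∀ u ∈ U, ∀ w ∈ W, B u w = 0)
    (p₁ q₁ p₂ q₂ : ℕ)
    (hU1 : posIdxH B U = p₁) (hU2 : negIdxH B U = q₁) (hU3 : finrank ℂ U = p₁ + q₁)
    (hW1 : posIdxH B W = p₂) (hW2 : negIdxH B W = q₂) (hW3 : finrank ℂ W = p₂ + q₂)
    (rU rW a aU aW : ℕ)
    (c1 : rU + a + aU ≤ p₁) (c2 : rU + a + aW ≤ q₁)
    (c3 : rW + a + aW ≤ p₂) (c4 : rW + a + aU ≤ q₂) :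
    ∃ S : Submodule ℂ V, (∀ s ∈ S, ∀ s' ∈ S, B s s' = 0) ∧
      finrank ℂ (S ⊓ U : Submodule ℂ V) = rU ∧
      finrank ℂ (S ⊓ W : Submodule ℂ V) = rW ∧
      finrank ℂ (sesqRad B (projAlong W U S)) = rU + a ∧
      posIdxH B (projAlong W U S) = aU ∧
      negIdxH B (projAlong W U S) = aW ∧
      finrank ℂ S = rU + rW + a + aU + aW := by
  obtain ⟨f, hfU, hfinj, hf⟩ := exists_diagonal_embedding (ρ := Fin rU ⊕ Fin a) (π := Fin aU)
    (ν := Fin aW) B hBherm U (by simpa [hU1] using c1) (by simpa [hU2] using c2)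
  obtain ⟨h, hhW, hhinj, hh⟩ := exists_diagonal_embedding (ρ := Fin rW ⊕ Fin a) (π := Fin aW)
    (ν := Fin aU) B hBherm W (by simpa [hW1] using c3) (by simpa [hW2] using c4)
  have hWU : ∀ w ∈ W, ∀ u ∈ U, B w u = 0 := fun w hw u hu => by
    rw [hBherm u w, horth u hu w hw, map_zero]
  have hzero : ∀ v ∈ U, v ∈ W → v = 0 := fun v hv hv' => by
    simpa [hUW] using Submodule.mem_inf.2 ⟨hv, hv'⟩
  let Φ : ((Fin rU → ℂ) × (Fin rW → ℂ) × (Fin a → ℂ) × (Fin aU → ℂ) × (Fin aW → ℂ)) →ₗ[ℂ] V :=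
    { toFun := fun (x, y, z, p, n) => f (Sum.elim x z, p, n) + h (Sum.elim y z, n, p)
      map_add' := fun (x, y, z, p, n) (x', y', z', p', n') => by
        simp only [Sum.elim_add_add]
        rw [← Prod.mk_add_mk, ← Prod.mk_add_mk, ← Prod.mk_add_mk, ← Prod.mk_add_mk, map_add,
          map_add]
        abel
      map_smul' := fun c (x, y, z, p, n) => by
        simp only [Prod.smul_mk, sumElim_smul_smul, RingHom.id_apply, smul_add, ← map_smul] }
  have hΦ : ∀ x y z p n, Φ (x, y, z, p, n) =
      f (Sum.elim x z, p, n) + h (Sum.elim y z, n, p) := fun _ _ _ _ _ => rfl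
  have hf0 : ∀ {x z p n}, f (Sum.elim x z, p, n) = 0 → x = 0 ∧ z = 0 ∧ p = 0 ∧ n = 0 :=
    fun {x z p n} h0 => by
      have := hfinj (h0.trans (map_zero f).symm)
      simp only [Prod.mk_eq_zero] at this
      obtain ⟨h1, h2, h3⟩ := this
      exact ⟨funext fun i => congrFun h1 (.inl i), funext fun i => congrFun h1 (.inr i), h2, h3⟩
  have hh0 : ∀ {x z p n}, h (Sum.elim x z, p, n) = 0 → x = 0 ∧ z = 0 ∧ p = 0 ∧ n = 0 :=
    fun {x z p n} h0 => by
      have := hhinj (h0.trans (map_zero h).symm)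
      simp only [Prod.mk_eq_zero] at this
      obtain ⟨h1, h2, h3⟩ := this
      exact ⟨funext fun i => congrFun h1 (.inl i), funext fun i => congrFun h1 (.inr i), h2, h3⟩
  have hΦinj : Function.Injective Φ := (injective_iff_map_eq_zero Φ).2 fun ⟨x, y, z, p, n⟩ h0 => by
    rw [hΦ] at h0
    have hfz : f (Sum.elim x z, p, n) = 0 := hzero _ (hfU _) (by
      rw [eq_neg_of_add_eq_zero_left h0]
      exact W.neg_mem (hhW _))
    rw [hfz, zero_add] at h0
    obtain ⟨rfl, rfl, rfl, rfl⟩ := hf0 hfz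
    obtain ⟨rfl, -⟩ := hh0 h0
    rfl
  have hSU : Φ.range ⊓ U = (Φ ∘ₗ LinearMap.inl ℂ _ _).range := by
    ext v
    constructor
    · rintro ⟨⟨⟨x, y, z, p, n⟩, rfl⟩, hv⟩
      obtain ⟨rfl, rfl, rfl, rfl⟩ := hh0 (hzero _ ((U.add_mem_iff_right (hfU _)).1 hv) (hhW _))
      exact ⟨x, rfl⟩
    · rintro ⟨x, rfl⟩
      refine ⟨⟨_, rfl⟩, ?_⟩
      have : h (0, 0, 0) = 0 := map_zero h
      simpa [hΦ, this] using hfU (Sum.elim x 0, 0, 0)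
  have hSW : Φ.range ⊓ W = (Φ ∘ₗ LinearMap.inr ℂ _ _ ∘ₗ LinearMap.inl ℂ _ _).range := by
    ext v
    constructor
    · rintro ⟨⟨⟨x, y, z, p, n⟩, rfl⟩, hv⟩
      obtain ⟨rfl, rfl, rfl, rfl⟩ := hf0 (hzero _ (hfU _) ((W.add_mem_iff_left (hhW _)).1 hv))
      exact ⟨y, rfl⟩
    · rintro ⟨y, rfl⟩
      refine ⟨⟨_, rfl⟩, ?_⟩
      have : f (0, 0, 0) = 0 := map_zero f
      simpa [hΦ, this] using hhW (Sum.elim y 0, 0, 0)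
  have hproj : projAlong W U Φ.range = f.range := by
    ext v
    constructor
    · rintro ⟨hv, hvU⟩
      obtain ⟨_, ⟨⟨x, y, z, p, n⟩, rfl⟩, w, hw, rfl⟩ := Submodule.mem_sup.1 hv
      rw [hΦ, add_assoc] at hvU ⊢
      rw [hzero _ ((U.add_mem_iff_right (hfU _)).1 hvU) (W.add_mem (hhW _) hw), add_zero]
      exact ⟨_, rfl⟩
    · rintro ⟨⟨xz, p, n⟩, rfl⟩
      refine ⟨Submodule.mem_sup.2 ⟨Φ (xz ∘ .inl, 0, xz ∘ .inr, p, n), ⟨_, rfl⟩,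
        -h (Sum.elim 0 (xz ∘ .inr), n, p), W.neg_mem (hhW _), ?_⟩, hfU _⟩
      rw [hΦ, Sum.elim_comp_inl_inr, add_neg_cancel_right]
  refine ⟨Φ.range, ?_, ?_, ?_, ?_, ?_, ?_, ?_⟩
  · rintro _ ⟨⟨x, y, z, p, n⟩, rfl⟩ _ ⟨⟨x', y', z', p', n'⟩, rfl⟩
    simp [hΦ, hf, hh, horth _ (hfU _) _ (hhW _), hWU _ (hhW _) _ (hfU _)]
  · rw [hSU, LinearMap.finrank_range_of_inj (f := Φ ∘ₗ _) (hΦinj.comp LinearMap.inl_injective)]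
    simp
  · rw [hSW, LinearMap.finrank_range_of_inj (f := Φ ∘ₗ _)
      (hΦinj.comp (LinearMap.inr_injective.comp LinearMap.inl_injective))]
    simp
  · rw [hproj, finrank_sesqRad_range B f hfinj hf]
    simp
  · rw [hproj, posIdxH_range B f hfinj hf]
    simp
  · rw [hproj, negIdxH_range B f hfinj hf]
    simp
  · rw [LinearMap.finrank_range_of_inj hΦinj]
    simp [add_assoc]
end
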